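/- Soundness of the accumulator computation: for every automaton M, node s, and set of nodes x, if x ⊆ tauclose M s, then tauclose_comp_aux M s x = tauclose M s. -/

import Mathlib

/-! Automata with a background state, actions, and τ-closure. -/

abbrev vname := String

inductive val where
  | Bool : Bool → val
  | Null : val
deriving DecidableEq

inductive action where
  | NoAct : action
  | AssAct : vname → val → action
deriving DecidableEq

structure edge (n : Type) where
  source : n
  action : action
  dest : n
deriving DecidableEq

structure ta (n : Type) where
  nodes : List n
  edges : List (edge n)
  init_s : n

/-- One step of the τ-closure computation: add `s` and all nodes reachable from
`x` by one silent transition. -/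
def tauclose_step {n : Type} (M : ta n) (s : n) (x : Set n) : Set n :=
  {s} ∪ x ∪ {nd | nd ∈ M.nodes ∧
    ∃ e ∈ M.edges, e.source ∈ x ∧ e.action = action.NoAct ∧ e.dest = nd}

lemma mono_tauclose_step {n : Type} (M : ta n) (s : n) :
    Monotone (tauclose_step M s) := by
  intro x y hxy
  rintro nd (h | ⟨hnd, e, he, hsrc, hact, hdst⟩)
  · exact Or.inl (by rcases h with h | h; exact Or.inl h; exact Or.inr (hxy h))
  · exact Or.inr ⟨hnd, e, he, hxy hsrc, hact, hdst⟩

/-- The τ-closure of a node: least fixpoint of `tauclose_step`. -/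
def tauclose {n : Type} (M : ta n) (s : n) : Set n :=
  OrderHom.lfp ⟨tauclose_step M s, mono_tauclose_step M s⟩
section TaucloseComp

open Classical in
/-- Computational version of the τ-closure: iterate `tauclose_step M s` on an
accumulator until a fixpoint is reached.  Termination is by the number of
elements of `s :: nodes M` not yet in the accumulator. -/
noncomputable def tauclose_comp_aux {n : Type} (M : ta n) (s : n) (x : Set n) : Set n :=
  if h : tauclose_step M s x = x then x
  else tauclose_comp_aux M s (tauclose_step M s x)
termination_by ((insert s M.nodes.toFinset).filter (fun v => v ∉ x)).card
decreasing_by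
  have hsub : x ⊆ tauclose_step M s x := fun a ha => Or.inl (Or.inr ha)
  obtain ⟨c, hcstep, hcx⟩ :=
    Set.exists_of_ssubset (hsub.ssubset_of_ne (fun e => h e.symm))
  have hcS : c ∈ insert s M.nodes.toFinset := by
    rcases hcstep with (hc | hc) | ⟨hc, _⟩
    · exact Finset.mem_insert.mpr (Or.inl hc)
    · exact absurd hc hcx
    · exact Finset.mem_insert.mpr (Or.inr (List.mem_toFinset.mpr hc))
  apply Finset.card_lt_card
  constructor
  · intro a ha
    rw [Finset.mem_filter] at ha ⊢
    exact ⟨ha.1, fun hax => ha.2 (hsub hax)⟩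
  · intro hcontra
    have hcmem : c ∈ (insert s M.nodes.toFinset).filter (fun v => v ∉ x) :=
      Finset.mem_filter.mpr ⟨hcS, hcx⟩
    have := Finset.mem_filter.mp (hcontra hcmem)
    exact this.2 hcstep

end TaucloseComp

/-- The τ-closure is a fixpoint of `tauclose_step`. -/
lemma tauclose_step_tauclose {n : Type} (M : ta n) (s : n) :
    tauclose_step M s (tauclose M s) = tauclose M s :=
  OrderHom.map_lfp ⟨tauclose_step M s, mono_tauclose_step M s⟩

/-- The τ-closure is contained in every fixpoint of `tauclose_step`. -/
lemma tauclose_subset_of_step_eq {n : Type} {M : ta n} {s : n} {x : Set n}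
    (hx : tauclose_step M s x = x) : tauclose M s ⊆ x :=
  OrderHom.lfp_le ⟨tauclose_step M s, mono_tauclose_step M s⟩ hx.le

/-- Soundness of the accumulator computation: if the accumulator
`x` is contained in `tauclose M s`, then the iteration computes `tauclose M s`. -/
theorem tauclose_comp_aux_sound {n : Type} (M : ta n) (s : n) (x : Set n)
    (h : x ⊆ tauclose M s) :
    tauclose_comp_aux M s x = tauclose M s := by
  induction x using tauclose_comp_aux.induct M s with
  | case1 x hx =>
    rw [tauclose_comp_aux, dif_pos hx]
    exact h.antisymm (tauclose_subset_of_step_eq hx)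
  | case2 x hx ih =>
    rw [tauclose_comp_aux, dif_neg hx]
    exact ih ((mono_tauclose_step M s h).trans (tauclose_step_tauclose M s).subset)
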